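/- arXiv:1609.07015 — 6 statements merged into one kernel-verified Lean document; each statement's English description precedes it below -/
import Mathlib

section
/- Let 𝒢 be a weighted digraph on n vertices with degree matrix Δ, Laplacian L(𝒢) = Δ − A and F(𝒢) = (I+Δ)⁻¹(I+A). Fix an index i, and let L_i(𝒢) and F_i(𝒢) denote the (n−1)×(n−1) matrices obtained from L(𝒢) and F(𝒢) respectively by deleting the i-th row and i-th column. Then det(L_i(𝒢)) ≠ 0 if and only if det(I − F_i(𝒢)) ≠ 0. -/
open Matrix

/-- For a weighted digraph with nonnegative adjacency matrix `A`,
degree matrix `Δ = diagonal (row sums of A)`, Laplacian `L = Δ - A` and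
`F = (I+Δ)⁻¹ (I+A)`, deleting the `i`-th row and column of `L` (resp. of `F`)
gives `L_i` (resp. `F_i`); then `det L_i ≠ 0 ↔ det (I - F_i) ≠ 0`. -/
theorem det_laplacian_minor_ne_zero_iff_det_one_sub_F_minor_ne_zero
    (n : ℕ) (A : Matrix (Fin (n + 1)) (Fin (n + 1)) ℝ)
    (hA : ∀ i j, 0 ≤ A i j)
    (Δ : Matrix (Fin (n + 1)) (Fin (n + 1)) ℝ)
    (hΔ : Δ = Matrix.diagonal fun i => ∑ j, A i j)
    (L F : Matrix (Fin (n + 1)) (Fin (n + 1)) ℝ)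
    (hL : L = Δ - A)
    (hF : F = (1 + Δ)⁻¹ * (1 + A))
    (i : Fin (n + 1)) :
    (L.submatrix i.succAbove i.succAbove).det ≠ 0 ↔
      ((1 : Matrix (Fin n) (Fin n) ℝ) - F.submatrix i.succAbove i.succAbove).det ≠ 0 := by
  set d : Fin (n + 1) → ℝ := fun k => 1 + ∑ j, A k j
  have hpos : ∀ k, d k ≠ 0 := fun k =>
    (add_pos_of_pos_of_nonneg one_pos (Finset.sum_nonneg fun j _ => hA k j)).ne'
  have hD : 1 + Δ = diagonal d := by
    rw [hΔ, ← diagonal_one, diagonal_add]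
  have hunit : IsUnit (1 + Δ).det := by
    rw [hD, det_diagonal]
    exact (Finset.prod_ne_zero_iff.mpr fun k _ => hpos k).isUnit
  have hDF : diagonal d * F = 1 + A := by
    rw [hF, ← hD, mul_nonsing_inv_cancel_left _ _ hunit]
  have hLF : L = diagonal d * (1 - F) := by
    rw [mul_sub, mul_one, hDF, ← hD, hL, add_sub_add_left_eq_sub]
  have hminor : L.submatrix i.succAbove i.succAbove =
      diagonal (d ∘ i.succAbove) * (1 - F.submatrix i.succAbove i.succAbove) := by
    ext a b
    simp [hLF, diagonal_mul, one_apply]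
  rw [hminor, det_mul, det_diagonal, mul_ne_zero_iff]
  exact and_iff_right (Finset.prod_ne_zero_iff.mpr fun k _ => hpos _)
end

section
/- If a weighted digraph 𝒢 on n vertices contains a rooted out-branching (equivalently, rank L(𝒢) = n−1), then the spectral radius of F(𝒢) = (I+Δ)⁻¹(I+A) equals 1, and 1 is an algebraically simple eigenvalue of F(𝒢) with corresponding eigenvector the all-ones vector 𝟙; in particular rank(I − F(𝒢)) = n − 1. -/
open Matrix

/-- A row-stochastic matrix cannot shift a vector by a nonzero constant. -/
theorem eq_zero_of_mulVec_sub_eq_const_of_mem_rowStochastic {ι : Type*} [Fintype ι]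
    [DecidableEq ι] [Nonempty ι] {M : Matrix ι ι ℝ} (hM : M ∈ rowStochastic ℝ ι)
    {v : ι → ℝ} {c : ℝ} (h : ∀ i, (M *ᵥ v) i - v i = c) : c = 0 := by
  have hsum (i : ι) (b : ℝ) : ∑ j, M i j * b = b := by
    rw [← Finset.sum_mul, sum_row_of_mem_rowStochastic hM, one_mul]
  obtain ⟨i, hi⟩ := Finite.exists_max v
  obtain ⟨k, hk⟩ := Finite.exists_min v
  have hle : (M *ᵥ v) i ≤ v i := by
    rw [← hsum i (v i)]
    exact Finset.sum_le_sum fun j _ => mul_le_mul_of_nonneg_left (hi j) (hM.1 i j)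
  have hge : v k ≤ (M *ᵥ v) k := by
    rw [← hsum k (v k)]
    exact Finset.sum_le_sum fun j _ => mul_le_mul_of_nonneg_left (hk j) (hM.1 k j)
  linarith [h i, h k]

theorem one_mem_spectrum_of_mulVec_one_eq_one {K ι : Type*} [Field K] [Fintype ι]
    [DecidableEq ι] [Nonempty ι] {M : Matrix ι ι K} (h : M *ᵥ 1 = 1) :
    (1 : K) ∈ spectrum K M := by
  rw [← spectrum_toLin', ← Module.End.hasEigenvalue_iff_mem_spectrum]
  refine Module.End.hasEigenvalue_of_hasEigenvector (x := 1) ?_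
  rw [Module.End.hasEigenvector_iff, Module.End.mem_eigenspace_iff]
  exact ⟨by simpa using h, one_ne_zero⟩

theorem spectralRadius_map_eq_one_of_mem_rowStochastic {ι : Type*} [Fintype ι]
    [DecidableEq ι] [Nonempty ι] {M : Matrix ι ι ℝ} (hM : M ∈ rowStochastic ℝ ι) :
    spectralRadius ℂ (M.map (algebraMap ℝ ℂ)) = 1 := by
  apply le_antisymm
  · let _ : NormedRing (Matrix ι ι ℂ) := Matrix.linftyOpNormedRing
    let _ : NormedAlgebra ℂ (Matrix ι ι ℂ) := Matrix.linftyOpNormedAlgebra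
    have : NormOneClass (Matrix ι ι ℂ) := Matrix.linfty_opNormOneClass
    have : CompleteSpace (Matrix ι ι ℂ) := FiniteDimensional.complete ℂ _
    refine (spectrum.spectralRadius_le_nnnorm (M.map (algebraMap ℝ ℂ))).trans ?_
    rw [ENNReal.coe_le_one_iff, Matrix.linfty_opNNNorm_def]
    refine Finset.sup_le fun i _ => ?_
    rw [← NNReal.coe_le_coe]
    push_cast
    refine le_of_eq ?_
    rw [← sum_row_of_mem_rowStochastic hM i]
    refine Finset.sum_congr rfl fun j _ => ?_
    simp [abs_of_nonneg (hM.1 i j)]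
  · have h : (1 : ℂ) ∈ spectrum ℂ (M.map (algebraMap ℝ ℂ)) := by
      refine one_mem_spectrum_of_mulVec_one_eq_one ?_
      ext i
      simpa [mulVec, dotProduct] using
        congrArg Complex.ofReal (sum_row_of_mem_rowStochastic hM i)
    simpa [spectralRadius] using le_iSup₂
      (f := fun (k : ℂ) (_ : k ∈ spectrum ℂ (M.map (algebraMap ℝ ℂ))) => (‖k‖₊ : ENNReal)) 1 h

theorem rootMultiplicity_charpoly_one_of_mem_rowStochastic {ι : Type*} [Fintype ι]
    [DecidableEq ι] [Nonempty ι] {M : Matrix ι ι ℝ} (hM : M ∈ rowStochastic ℝ ι)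
    (hrank : (1 - M).rank = Fintype.card ι - 1) :
    M.charpoly.rootMultiplicity 1 = 1 := by
  have hone : (1 : ι → ℝ) ∈ LinearMap.ker (1 - M).mulVecLin := by
    simp [hM.2]
  have hker : Module.finrank ℝ (LinearMap.ker (1 - M).mulVecLin) = 1 := by
    have h := (1 - M).mulVecLin.finrank_range_add_finrank_ker
    rw [Module.finrank_fintype_fun_eq_card] at h
    have h' : Module.finrank ℝ (LinearMap.range (1 - M).mulVecLin) = Fintype.card ι - 1 := hrank
    have := Fintype.card_pos (α := ι)
    omega
  have hf : toLin' M - (1 : ℝ) • (1 : Module.End ℝ (ι → ℝ)) = -(1 - M).mulVecLin := by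
    ext; simp
  have hspan (w : ι → ℝ) (hw : (1 - M) *ᵥ w = 0) : ∃ c : ℝ, ∀ i, w i = c := by
    obtain ⟨c, hc⟩ := (finrank_eq_one_iff_of_nonzero'
      (⟨1, hone⟩ : LinearMap.ker (1 - M).mulVecLin) (by simp [Subtype.ext_iff])).1 hker ⟨w, hw⟩
    refine ⟨c, fun i => ?_⟩
    simpa using (congrFun (congrArg Subtype.val hc) i).symm
  have hsq (v : ι → ℝ) (hv : (1 - M) *ᵥ ((1 - M) *ᵥ v) = 0) : (1 - M) *ᵥ v = 0 := by
    obtain ⟨c, hc⟩ := hspan _ hv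
    have h : -c = 0 := eq_zero_of_mulVec_sub_eq_const_of_mem_rowStochastic hM (v := v) fun i => by
      rw [← hc i, sub_mulVec, one_mulVec, Pi.sub_apply, neg_sub]
    ext i
    rw [hc i, Pi.zero_apply, ← neg_eq_zero, h]
  have hpow (k : ℕ) (v : ι → ℝ) (hv : ((-(1 - M).mulVecLin) ^ k) v = 0) :
      (1 - M) *ᵥ v = 0 := by
    induction k generalizing v with
    | zero => simp_all
    | succ k ih =>
      rw [pow_succ, Module.End.mul_apply] at hv
      have h := ih _ hv
      rw [LinearMap.neg_apply, mulVecLin_apply, mulVec_neg, neg_eq_zero] at h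
      exact hsq v h
  have hgen : Module.End.maxGenEigenspace (toLin' M) 1 = LinearMap.ker (1 - M).mulVecLin := by
    ext v
    rw [Module.End.mem_maxGenEigenspace, hf, LinearMap.mem_ker, mulVecLin_apply]
    refine ⟨fun ⟨k, hk⟩ => hpow k v hk, fun h => ⟨1, ?_⟩⟩
    rw [pow_one, LinearMap.neg_apply, mulVecLin_apply, h, neg_zero]
  rw [← charpoly_toLin', ← LinearMap.finrank_maxGenEigenspace_eq, hgen, hker]

/-- If a weighted digraph contains a rooted out-branching
(equivalently `rank L = n - 1`), then the spectral radius of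
`F = (I+Δ)⁻¹(I+A)` equals 1, `1` is an algebraically simple eigenvalue of `F`
with eigenvector the all-ones vector, and `rank (I - F) = n - 1`. -/
theorem spectral_properties_of_F_of_rooted_out_branching
    (n : ℕ) (hn : 0 < n) (A : Matrix (Fin n) (Fin n) ℝ)
    (hA : ∀ i j, 0 ≤ A i j)
    (Δ : Matrix (Fin n) (Fin n) ℝ)
    (hΔ : Δ = Matrix.diagonal fun i => ∑ j, A i j)
    (L F : Matrix (Fin n) (Fin n) ℝ)
    (hL : L = Δ - A)
    (hF : F = (1 + Δ)⁻¹ * (1 + A))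
    -- the digraph contains a rooted out-branching, equivalently:
    (hrank : L.rank = n - 1) :
    spectralRadius ℂ (F.map (algebraMap ℝ ℂ)) = 1 ∧
      F.charpoly.rootMultiplicity 1 = 1 ∧
      F *ᵥ (fun _ => (1 : ℝ)) = (fun _ => (1 : ℝ)) ∧
      ((1 : Matrix (Fin n) (Fin n) ℝ) - F).rank = n - 1 := by
  have hpos (i : Fin n) : 0 < 1 + ∑ j, A i j :=
    add_pos_of_pos_of_nonneg one_pos (Finset.sum_nonneg fun j _ => hA i j)
  have : Nonempty (Fin n) := ⟨⟨0, hn⟩⟩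
  have hD : 1 + Δ = diagonal fun i => 1 + ∑ j, A i j := by
    rw [hΔ, ← diagonal_one, diagonal_add]
  have hdet : IsUnit (1 + Δ).det := by
    rw [hD, det_diagonal]
    exact (Finset.prod_ne_zero_iff.2 fun i _ => (hpos i).ne').isUnit
  have hDF : (1 + Δ) * F = 1 + A := by
    rw [hF, mul_nonsing_inv_cancel_left _ _ hdet]
  have hentry (i j : Fin n) : (1 + ∑ k, A i k) * F i j = (1 + A) i j := by
    rw [← hDF, hD, diagonal_mul]
  have hstoch : F ∈ rowStochastic ℝ (Fin n) := by
    rw [mem_rowStochastic_iff_sum]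
    refine ⟨fun i j => ?_, fun i => ?_⟩
    · refine nonneg_of_mul_nonneg_right ?_ (hpos i)
      rw [hentry, Matrix.add_apply, one_apply]
      have := hA i j
      split_ifs <;> positivity
    · apply mul_left_cancel₀ (hpos i).ne'
      rw [Finset.mul_sum, mul_one]
      simp_rw [hentry, Matrix.add_apply, Finset.sum_add_distrib]
      simp [one_apply]
  have hrankF : (1 - F).rank = n - 1 := by
    rw [← hrank, ← rank_mul_eq_right_of_isUnit_det _ (1 - F) hdet, mul_sub, hDF, mul_one, hL,
      add_sub_add_left_eq_sub]
  exact ⟨spectralRadius_map_eq_one_of_mem_rowStochastic hstoch,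
    rootMultiplicity_charpoly_one_of_mem_rowStochastic hstoch (by simpa using hrankF),
    hstoch.2, hrankF⟩
end

section
/- If a weighted digraph 𝒢 on n vertices contains a rooted out-branching (equivalently, rank L(𝒢) = n−1), then the matrix powers F(𝒢)^k converge as k → ∞, and the limit is the rank-one matrix 𝟙 cᵀ, where 𝟙 is the all-ones vector and c is a nonnegative vector satisfying cᵀ𝟙 = 1. -/
open Matrix Filter

/-- A nonempty set `S` of indices, closed under the edges `i → j` with `M i j ≠ 0`, of a matrix with
zero row sums carries a nonzero left null vector. -/
theorem exists_vecMul_eq_zero_of_closed {ι : Type*} [Fintype ι] [DecidableEq ι]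
    (M : Matrix ι ι ℝ) (hM : ∀ i, ∑ j, M i j = 0) (S : Set ι) (hS : S.Nonempty)
    (hcl : ∀ i ∈ S, ∀ j ∉ S, M i j = 0) :
    ∃ u : ι → ℝ, u ≠ 0 ∧ (∀ j ∉ S, u j = 0) ∧ u ᵥ* M = 0 := by
  classical
  let N : Matrix ι ι ℝ := fun i j => if i ∈ S then M i j else (1 : Matrix ι ι ℝ) i j
  have hdet : N.det = 0 := by
    rw [← Matrix.exists_mulVec_eq_zero_iff]
    obtain ⟨s, hs⟩ := hS
    refine ⟨S.indicator 1, fun h => by simpa [hs] using congrFun h s, ?_⟩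
    ext i
    by_cases hi : i ∈ S
    · simp only [mulVec, dotProduct, N, hi, if_true, Pi.zero_apply]
      rw [← hM i]
      refine Finset.sum_congr rfl fun j _ => ?_
      by_cases hj : j ∈ S <;> simp [hj, hcl i hi]
    · simp [mulVec, dotProduct, N, hi, Matrix.one_apply]
  obtain ⟨u, hu0, hu⟩ := Matrix.exists_vecMul_eq_zero_iff.2 hdet
  have hsupp : ∀ j ∉ S, u j = 0 := by
    intro j hj
    have h := congrFun hu j
    simp only [vecMul, dotProduct, Pi.zero_apply] at h
    rw [Finset.sum_eq_single j] at h
    · simpa [N, hj] using h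
    · intro i _ hij
      by_cases hi : i ∈ S
      · simp [N, hi, hcl i hi j hj]
      · simp [N, hi, Matrix.one_apply, hij]
    · simp
  refine ⟨u, hu0, hsupp, ?_⟩
  rw [← hu]
  ext j
  simp only [vecMul, dotProduct]
  refine Finset.sum_congr rfl fun i _ => ?_
  by_cases hi : i ∈ S
  · simp [N, hi]
  · simp [hsupp i hi]

/-- Two nonempty closed sets of indices of a square matrix of corank at most one with zero row sums
intersect. -/
theorem not_disjoint_of_closed_of_rank {ι : Type*} [Fintype ι] [DecidableEq ι]
    (M : Matrix ι ι ℝ) (hM : ∀ i, ∑ j, M i j = 0) (hr : Fintype.card ι ≤ M.rank + 1)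
    (S T : Set ι) (hS : S.Nonempty) (hT : T.Nonempty)
    (hScl : ∀ i ∈ S, ∀ j ∉ S, M i j = 0) (hTcl : ∀ i ∈ T, ∀ j ∉ T, M i j = 0) :
    ¬ Disjoint S T := by
  intro hd
  obtain ⟨u, hu0, hus, hu⟩ := exists_vecMul_eq_zero_of_closed M hM S hS hScl
  obtain ⟨w, hw0, hws, hw⟩ := exists_vecMul_eq_zero_of_closed M hM T hT hTcl
  have hker : Module.finrank ℝ (LinearMap.ker Mᵀ.mulVecLin) ≤ 1 := by
    have h := LinearMap.finrank_range_add_finrank_ker Mᵀ.mulVecLin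
    have h' : Mᵀ.rank = M.rank := Matrix.rank_transpose M
    rw [Matrix.rank] at h'
    rw [Module.finrank_fintype_fun_eq_card] at h
    omega
  obtain ⟨g, hg⟩ := finrank_le_one_iff.1 hker
  obtain ⟨a, ha⟩ := hg ⟨u, by simpa [Matrix.mulVec_transpose] using hu⟩
  obtain ⟨b, hb⟩ := hg ⟨w, by simpa [Matrix.mulVec_transpose] using hw⟩
  replace ha : a • (g : ι → ℝ) = u := congrArg Subtype.val ha
  replace hb : b • (g : ι → ℝ) = w := congrArg Subtype.val hb
  obtain ⟨i, hi⟩ := Function.ne_iff.1 hu0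
  have hiT : i ∉ T := fun hT' =>
    hi (hus i fun hS' => Set.disjoint_left.1 hd hS' hT')
  have hwi := hws i hiT
  rw [← hb] at hwi
  rw [← ha] at hi
  have hb0 : b ≠ 0 := by
    rintro rfl
    exact hw0 (by simpa using hb.symm)
  simp [hb0] at hwi
  simp [hwi] at hi

/-- A row-stochastic matrix bounds the averages of a vector by the bounds of the vector, with an
improvement when a column is bounded below by `ε`. -/
theorem mulVec_sub_mulVec_le {ι : Type*} [Fintype ι] [DecidableEq ι]
    {P : Matrix ι ι ℝ} (hP : P ∈ rowStochastic ℝ ι) {r : ι} {ε : ℝ}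
    (hε : ∀ i, ε ≤ P i r) {x : ι → ℝ} {b : ℝ} (hx : ∀ i j, x i - x j ≤ b) (i j : ι) :
    (P *ᵥ x) i - (P *ᵥ x) j ≤ (1 - ε) * b := by
  have : Nonempty ι := ⟨r⟩
  obtain ⟨p, hp⟩ := Finite.exists_max x
  obtain ⟨q, hq⟩ := Finite.exists_min x
  have hnn : ∀ i j, 0 ≤ P i j - ε * (if j = r then 1 else 0) := by
    intro i j
    split_ifs with h
    · subst h
      linarith [hε i]
    · simpa using hP.1 i j
  have hsum : ∀ i, ∑ j, (P i j - ε * (if j = r then 1 else 0)) = 1 - ε := by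
    intro i
    simp [Finset.sum_sub_distrib, sum_row_of_mem_rowStochastic hP]
  have hmul : ∀ i, (P *ᵥ x) i = ∑ j, (P i j - ε * (if j = r then 1 else 0)) * x j + ε * x r := by
    intro i
    simp [mulVec, dotProduct, sub_mul, Finset.sum_sub_distrib]
  have hup : ∑ k, (P i k - ε * (if k = r then 1 else 0)) * x k ≤ (1 - ε) * x p := by
    rw [← hsum i, Finset.sum_mul]
    exact Finset.sum_le_sum fun k _ => mul_le_mul_of_nonneg_left (hp k) (hnn i k)
  have hlo : (1 - ε) * x q ≤ ∑ k, (P j k - ε * (if k = r then 1 else 0)) * x k := by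
    rw [← hsum j, Finset.sum_mul]
    exact Finset.sum_le_sum fun k _ => mul_le_mul_of_nonneg_left (hq k) (hnn j k)
  have h1 : 0 ≤ 1 - ε := by
    rw [← hsum i]
    exact Finset.sum_nonneg fun k _ => hnn i k
  have h2 := mul_le_mul_of_nonneg_left (hx p q) h1
  rw [hmul i, hmul j]
  linarith

/-- Averaging a vector by a row-stochastic matrix moves its entries by at most its oscillation. -/
theorem abs_mulVec_sub_le {ι : Type*} [Fintype ι] [DecidableEq ι]
    {P : Matrix ι ι ℝ} (hP : P ∈ rowStochastic ℝ ι)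
    {x : ι → ℝ} {b : ℝ} (hx : ∀ i j, x i - x j ≤ b) (i j : ι) :
    |(P *ᵥ x) i - x j| ≤ b := by
  have h : (P *ᵥ x) i - x j = ∑ k, P i k * (x k - x j) := by
    simp [mulVec, dotProduct, mul_sub, Finset.sum_sub_distrib, ← Finset.sum_mul,
      sum_row_of_mem_rowStochastic hP]
  have hb : b = ∑ k, P i k * b := by
    rw [← Finset.sum_mul, sum_row_of_mem_rowStochastic hP, one_mul]
  rw [h, hb]
  refine (Finset.abs_sum_le_sum_abs _ _).trans (Finset.sum_le_sum fun k _ => ?_)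
  rw [abs_mul, abs_of_nonneg (hP.1 i k)]
  exact mul_le_mul_of_nonneg_left (abs_sub_le_iff.2 ⟨hx k j, hx j k⟩) (hP.1 i k)

/-- If some power of a row-stochastic matrix has a positive column, its powers converge to a
rank-one row-stochastic matrix. -/
theorem tendsto_pow_of_mem_rowStochastic {ι : Type*} [Fintype ι] [DecidableEq ι]
    {F : Matrix ι ι ℝ} (hF : F ∈ rowStochastic ℝ ι) {N : ℕ} {r : ι}
    (hpos : ∀ i, 0 < (F ^ N) i r) :
    ∃ c : ι → ℝ, (∀ i, 0 ≤ c i) ∧ (∑ i, c i = 1) ∧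
      Tendsto (fun k : ℕ => F ^ k) atTop (nhds (vecMulVec (fun _ => (1 : ℝ)) c)) := by
  have : Nonempty ι := ⟨r⟩
  have hFk : ∀ k, F ^ k ∈ rowStochastic ℝ ι := fun k => pow_mem hF k
  obtain ⟨p, hp⟩ := Finite.exists_min fun i => (F ^ N) i r
  set ε := (F ^ N) p r
  have hε0 : 0 < ε := hpos p
  have hε1 : ε ≤ 1 := le_one_of_mem_rowStochastic (hFk N)
  have hosc : ∀ k i i' j, (F ^ (N * k)) i j - (F ^ (N * k)) i' j ≤ (1 - ε) ^ k := by
    intro k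
    induction k with
    | zero =>
      intro i i' j
      have h1 := le_one_of_mem_rowStochastic (hFk 0) (i := i) (j := j)
      have h2 := (hFk 0).1 i' j
      simp only [mul_zero, pow_zero] at *
      linarith
    | succ k ih =>
      intro i i' j
      have h := mulVec_sub_mulVec_le (hFk N) hp (x := fun i => (F ^ (N * k)) i j)
        (fun i i' => ih i i' j) i i'
      rw [Nat.mul_succ, add_comm, pow_add, pow_succ' (1 - ε)]
      exact h
  have hmove : ∀ k m i i' j, N * k ≤ m →
      |(F ^ m) i j - (F ^ (N * k)) i' j| ≤ (1 - ε) ^ k := by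
    intro k m i i' j hm
    have h := abs_mulVec_sub_le (hFk (m - N * k)) (x := fun i => (F ^ (N * k)) i j)
      (fun i i' => hosc k i i' j) i i'
    rw [← Nat.sub_add_cancel hm, pow_add]
    exact h
  have hgeo : Tendsto (fun k : ℕ => (1 - ε) ^ k) atTop (nhds 0) :=
    tendsto_pow_atTop_nhds_zero_of_lt_one (by linarith) (by linarith)
  have hcauchy : ∀ j, CauchySeq fun k => (F ^ k) r j := by
    intro j
    rw [Metric.cauchySeq_iff']
    intro δ hδ
    obtain ⟨k, hk⟩ := (hgeo.eventually_lt_const hδ).exists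
    exact ⟨N * k, fun m hm => (hmove k m r r j hm).trans_lt hk⟩
  choose c hc using fun j => cauchySeq_tendsto_of_complete (hcauchy j)
  have hlim : ∀ i j, Tendsto (fun k => (F ^ k) i j) atTop (nhds (c j)) := by
    intro i j
    have hdiff : Tendsto (fun k => (F ^ k) i j - (F ^ k) r j) atTop (nhds 0) := by
      rw [Metric.tendsto_atTop]
      intro δ hδ
      obtain ⟨k, hk⟩ := (hgeo.eventually_lt_const (half_pos hδ)).exists
      refine ⟨N * k, fun m hm => ?_⟩
      have h1 := abs_le.1 (hmove k m i r j hm)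
      have h2 := abs_le.1 (hmove k m r r j hm)
      rw [Real.dist_eq, sub_zero, abs_lt]
      constructor <;> linarith
    simpa using hdiff.add (hc j)
  refine ⟨c, fun j => ge_of_tendsto' (hc j) fun k => (hFk k).1 r j, ?_, ?_⟩
  · refine tendsto_nhds_unique (tendsto_finsetSum _ fun j _ => hc j) ?_
    simp [fun k => sum_row_of_mem_rowStochastic (hFk k) r]
  · refine tendsto_pi_nhds.2 fun i => tendsto_pi_nhds.2 fun j => ?_
    simpa [vecMulVec] using hlim i j

/-- If any two nonempty closed sets of indices of a row-stochastic matrix with positive diagonal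
intersect, then some power of the matrix has a positive column. -/
theorem exists_pow_column_pos {ι : Type*} [Fintype ι] [DecidableEq ι] [Nonempty ι]
    {F : Matrix ι ι ℝ} (hF : F ∈ rowStochastic ℝ ι) (hdiag : ∀ i, 0 < F i i)
    (hcl : ∀ S T : Set ι, S.Nonempty → T.Nonempty → (∀ i ∈ S, ∀ j ∉ S, F i j = 0) →
      (∀ i ∈ T, ∀ j ∉ T, F i j = 0) → ¬ Disjoint S T) :
    ∃ (N : ℕ) (r : ι), ∀ i, 0 < (F ^ N) i r := by
  have hFk : ∀ k, F ^ k ∈ rowStochastic ℝ ι := fun k => pow_mem hF k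
  have hadd : ∀ a b i j l, 0 < (F ^ a) i j → 0 < (F ^ b) j l → 0 < (F ^ (a + b)) i l := by
    intro a b i j l h1 h2
    rw [pow_add, Matrix.mul_apply]
    exact Finset.sum_pos' (fun k _ => mul_nonneg ((hFk a).1 i k) ((hFk b).1 k l))
      ⟨j, Finset.mem_univ j, mul_pos h1 h2⟩
  have hdiagk : ∀ k i, 0 < (F ^ k) i i := by
    intro k i
    induction k with
    | zero => simp
    | succ k ih => exact hadd k 1 i i i ih (by simpa using hdiag i)
  let R : ι → Set ι := fun i => {j | ∃ k, 0 < (F ^ k) i j}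
  have hself : ∀ i, i ∈ R i := fun i => ⟨0, hdiagk 0 i⟩
  have hsub : ∀ i j, j ∈ R i → R j ⊆ R i := by
    rintro i j ⟨a, ha⟩ l ⟨b, hb⟩
    exact ⟨a + b, hadd a b i j l ha hb⟩
  have hRcl : ∀ i, ∀ j ∈ R i, ∀ l ∉ R i, F j l = 0 := by
    intro i j hj l hl
    by_contra h
    exact hl (hsub i j hj ⟨1, by simpa using lt_of_le_of_ne (hF.1 j l) (Ne.symm h)⟩)
  obtain ⟨r, hr⟩ := Finite.exists_min fun i => (R i).ncard
  have hroot : ∀ i, r ∈ R i := by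
    intro i
    obtain ⟨j, hjr, hji⟩ := Set.not_disjoint_iff.1
      (hcl (R r) (R i) ⟨r, hself r⟩ ⟨i, hself i⟩ (hRcl r) (hRcl i))
    have heq : R j = R r :=
      Set.eq_of_subset_of_ncard_le (hsub r j hjr) (hr j) (Set.toFinite _)
    exact hsub i j hji (heq ▸ hself r)
  choose k hk using hroot
  refine ⟨∑ i, k i, r, fun i => ?_⟩
  rw [← Nat.add_sub_cancel' (Finset.single_le_sum (fun i _ => Nat.zero_le (k i))
    (Finset.mem_univ i))]
  exact hadd _ _ i r r (hk i) (hdiagk _ r)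

/-- If a weighted digraph contains a rooted out-branching
(equivalently `rank L = n - 1`), then the powers `F^k` of
`F = (I+Δ)⁻¹(I+A)` converge to the rank-one matrix `𝟙 cᵀ` where `c ≥ 0`
and `cᵀ 𝟙 = 1`. -/
theorem powers_of_F_tendsto_rank_one_of_rooted_out_branching
    (n : ℕ) (hn : 0 < n) (A : Matrix (Fin n) (Fin n) ℝ)
    (hA : ∀ i j, 0 ≤ A i j)
    (Δ : Matrix (Fin n) (Fin n) ℝ)
    (hΔ : Δ = Matrix.diagonal fun i => ∑ j, A i j)
    (L F : Matrix (Fin n) (Fin n) ℝ)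
    (hL : L = Δ - A)
    (hF : F = (1 + Δ)⁻¹ * (1 + A))
    -- the digraph contains a rooted out-branching, equivalently:
    (hrank : L.rank = n - 1) :
    ∃ c : Fin n → ℝ, (∀ i, 0 ≤ c i) ∧ (∑ i, c i = 1) ∧
      Tendsto (fun k : ℕ => F ^ k) atTop
        (nhds (Matrix.vecMulVec (fun _ => (1 : ℝ)) c)) := by
  have : Nonempty (Fin n) := ⟨⟨0, hn⟩⟩
  have hpos : ∀ i, 0 < 1 + ∑ j, A i j := fun i =>
    add_pos_of_pos_of_nonneg one_pos (Finset.sum_nonneg fun j _ => hA i j)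
  have hFe : ∀ i j, F i j = (1 + ∑ j, A i j)⁻¹ * ((1 : Matrix _ _ ℝ) i j + A i j) := by
    have hinv : (1 + Δ)⁻¹ = diagonal fun i => (1 + ∑ j, A i j)⁻¹ := by
      refine Matrix.inv_eq_left_inv ?_
      rw [hΔ, ← Matrix.diagonal_one, Matrix.diagonal_add, Matrix.diagonal_mul_diagonal]
      congr 1
      ext i
      exact inv_mul_cancel₀ (hpos i).ne'
    intro i j
    rw [hF, hinv, Matrix.diagonal_mul, Matrix.add_apply]
  have hFst : F ∈ rowStochastic ℝ (Fin n) := by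
    rw [mem_rowStochastic_iff_sum]
    refine ⟨fun i j => ?_, fun i => ?_⟩
    · rw [hFe]
      refine mul_nonneg (inv_nonneg.2 (hpos i).le) (add_nonneg ?_ (hA i j))
      rw [Matrix.one_apply]
      split_ifs <;> norm_num
    · simp only [hFe, ← Finset.mul_sum, Finset.sum_add_distrib]
      rw [show ∑ j, (1 : Matrix (Fin n) (Fin n) ℝ) i j = 1 by simp [Matrix.one_apply]]
      exact inv_mul_cancel₀ (hpos i).ne'
  have hdiag : ∀ i, 0 < F i i := by
    intro i
    rw [hFe, Matrix.one_apply_eq]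
    exact mul_pos (inv_pos.2 (hpos i)) (add_pos_of_pos_of_nonneg one_pos (hA i i))
  have hLsum : ∀ i, ∑ j, L i j = 0 := by
    intro i
    simp [hL, hΔ, Matrix.diagonal_apply, Finset.sum_sub_distrib]
  have hLF : ∀ S : Set (Fin n), (∀ i ∈ S, ∀ j ∉ S, F i j = 0) →
      ∀ i ∈ S, ∀ j ∉ S, L i j = 0 := by
    intro S hS i hi j hj
    have hij : i ≠ j := by
      rintro rfl
      exact hj hi
    have h := hS i hi j hj
    rw [hFe, Matrix.one_apply_ne hij, zero_add] at h
    rw [hL, hΔ, Matrix.sub_apply, Matrix.diagonal_apply_ne _ hij,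
      (mul_eq_zero.1 h).resolve_left (inv_ne_zero (hpos i).ne'), sub_zero]
  obtain ⟨N, r, hr⟩ := exists_pow_column_pos hFst hdiag fun S T hS hT hScl hTcl =>
    not_disjoint_of_closed_of_rank L hLsum (by rw [Fintype.card_fin]; omega) S T hS hT
      (hLF S hScl) (hLF T hTcl)
  exact tendsto_pow_of_mem_rowStochastic hFst hr
end

section
/- Suppose the sensor graph 𝒢 on {1,…,n} has distinguished vertex 1 with no incoming edges (N_1 = ∅) and every vertex is reachable from vertex 1 by a directed path, the pairwise associations are noiseless, i.e. Π̃_{ij} = Π_{i0} Π_{j0}ᵀ for permutation matrices Π_{10},…,Π_{n0}, and Π_1(0) is an m×m permutation matrix. Then, for arbitrary initial m×m real matrices Π_i(0) (i ≥ 2), the consensus protocol converges: lim_{t→∞} Π_i(t) = Π_{i0} Π_0 for every i, where Π_0 = Π_{10}ᵀ Π_1(0). In particular, the limiting labels are a consistent set of labels for {Π̃_{ij}} up to the single global permutation Π_0. -/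
open Matrix Filter

/-- An `m × m` real matrix is a permutation matrix if it is the matrix
representation of some permutation `σ` of `{1,…,m}`. -/
def IsPermMatrix {m : ℕ} (M : Matrix (Fin m) (Fin m) ℝ) : Prop :=
  ∃ σ : Equiv.Perm (Fin m), M = fun i j => if σ j = i then 1 else 0

theorem ENNReal.limsup_add_le_limsup_add_limsup {ι : Type*} {f : Filter ι} (u v : ι → ENNReal) :
    limsup (fun i => u i + v i) f ≤ limsup u f + limsup v f := by
  refine ENNReal.le_of_forall_pos_le_add fun ε hε hfin => ?_
  obtain ⟨hu, hv⟩ := ENNReal.add_lt_top.1 hfin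
  have hε2 : (ε / 2 : ENNReal) ≠ 0 := by simpa using hε.ne'
  refine limsup_le_of_le (h := ?_)
  filter_upwards [eventually_lt_of_limsup_lt (ENNReal.lt_add_right hu.ne hε2),
    eventually_lt_of_limsup_lt (ENNReal.lt_add_right hv.ne hε2)] with i hui hvi
  calc u i + v i ≤ (limsup u f + ε / 2) + (limsup v f + ε / 2) := add_le_add hui.le hvi.le
    _ = limsup u f + limsup v f + ε := by rw [add_add_add_comm, ENNReal.add_halves]

theorem ENNReal.limsup_finsetSum_le {ι : Type*} (s : Finset ι) (e : ℕ → ι → ENNReal) :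
    limsup (fun t => ∑ j ∈ s, e t j) atTop ≤ ∑ j ∈ s, limsup (fun t => e t j) atTop := by
  classical
  induction s using Finset.induction_on with
  | empty => simp
  | insert a s ha ih =>
    simp only [Finset.sum_insert ha]
    exact (ENNReal.limsup_add_le_limsup_add_limsup _ _).trans (add_le_add le_rfl ih)

/-- Averaging over in-neighborhoods drives every state to zero when a vertex from which all others
are reachable is held at zero. -/
theorem tendsto_zero_of_averaging {ι E : Type*} [Finite ι] [NormedAddCommGroup E]
    [NormedSpace ℝ E] (N : ι → Finset ι) (r : ι)
    (hreach : ∀ i, Relation.ReflTransGen (fun a b => a ∈ N b) r i)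
    (y : ℕ → ι → E) (hr : ∀ t, y t r = 0)
    (hupdate : ∀ t i, y (t + 1) i = (((N i).card : ℝ) + 1)⁻¹ • (y t i + ∑ j ∈ N i, y t j))
    (i : ι) : Tendsto (fun t => y t i) atTop (nhds 0) := by
  have : Nonempty ι := ⟨r⟩
  have : Fintype ι := Fintype.ofFinite ι
  have step (t : ℕ) (i : ι) :
      ((N i).card + 1 : ENNReal) * ‖y (t + 1) i‖ₑ ≤ ‖y t i‖ₑ + ∑ j ∈ N i, ‖y t j‖ₑ := by
    have hpos : (0 : ℝ) < (N i).card + 1 := by positivity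
    have h : y t i + ∑ j ∈ N i, y t j = (((N i).card : ℝ) + 1) • y (t + 1) i := by
      rw [hupdate, smul_inv_smul₀ hpos.ne']
    have hc : ‖((N i).card : ℝ) + 1‖ₑ = ((N i).card + 1 : ENNReal) := by
      rw [Real.enorm_of_nonneg hpos.le, ENNReal.ofReal_add (by positivity) zero_le_one]
      simp
    rw [← hc, ← enorm_smul, ← h]
    exact (enorm_add_le _ _).trans (add_le_add le_rfl (enorm_sum_le _ _))
  have hbound (t : ℕ) (i : ι) : ‖y t i‖ₑ ≤ ∑ j, ‖y 0 j‖ₑ := by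
    induction t generalizing i with
    | zero => exact Finset.single_le_sum (f := fun j => ‖y 0 j‖ₑ) (by simp) (Finset.mem_univ i)
    | succ t ih =>
      have h : ((N i).card + 1 : ENNReal) * ‖y (t + 1) i‖ₑ
          ≤ ((N i).card + 1 : ENNReal) * ∑ j, ‖y 0 j‖ₑ := by
        refine (step t i).trans ((add_le_add (ih i) (Finset.sum_le_sum fun j _ => ih j)).trans ?_)
        simp [add_mul, add_comm]
      exact (ENNReal.mul_le_mul_iff_right (by simp) (by finiteness)).1 h
  set L : ι → ENNReal := fun i => limsup (fun t => ‖y t i‖ₑ) atTop with hL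
  have hfin (i : ι) : L i ≠ ⊤ :=
    ne_top_of_le_ne_top (b := ∑ j, ‖y 0 j‖ₑ) (by simp)
      (limsup_le_of_le (h := Eventually.of_forall fun t => hbound t i))
  have havg (i : ι) : (N i).card * L i ≤ ∑ j ∈ N i, L j := by
    have h : ((N i).card + 1 : ENNReal) * L i ≤ L i + ∑ j ∈ N i, L j := by
      calc ((N i).card + 1 : ENNReal) * L i
          = limsup (fun t => ((N i).card + 1 : ENNReal) * ‖y (t + 1) i‖ₑ) atTop := by
            rw [ENNReal.limsup_const_mul_of_ne_top (by finiteness),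
              limsup_nat_add (fun t => ‖y t i‖ₑ) 1]
        _ ≤ limsup (fun t => ‖y t i‖ₑ + ∑ j ∈ N i, ‖y t j‖ₑ) atTop :=
            limsup_le_limsup (Eventually.of_forall fun t => step t i)
        _ ≤ L i + ∑ j ∈ N i, L j :=
            (ENNReal.limsup_add_le_limsup_add_limsup _ _).trans
              (add_le_add le_rfl (ENNReal.limsup_finsetSum_le _ fun t j => ‖y t j‖ₑ))
    rw [add_mul, one_mul, add_comm] at h
    exact (ENNReal.add_le_add_iff_left (hfin i)).1 h
  obtain ⟨k, hk⟩ := Finite.exists_max L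
  have hmax (i : ι) (hi : L i = L k) : L k = 0 := by
    induction hreach i with
    | refl => simpa [hL, hr] using hi.symm
    | @tail a b _ hab ih =>
      refine ih ((hk a).antisymm ?_)
      by_contra! hlt
      lift L to ι → NNReal using hfin with ℓ
      have hle : (N b).card * ℓ b ≤ ∑ j ∈ N b, ℓ j := mod_cast havg b
      have h : ∑ j ∈ N b, ℓ j < ∑ _j ∈ N b, ℓ k :=
        Finset.sum_lt_sum (fun j _ => mod_cast hk j) ⟨a, hab, mod_cast hlt⟩
      rw [Finset.sum_const, nsmul_eq_mul, ← (mod_cast hi : ℓ b = ℓ k)] at h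
      exact h.not_ge hle
  have hzero : L i = 0 := le_antisymm ((hk i).trans (hmax k rfl).le) bot_le
  rw [tendsto_zero_iff_enorm_tendsto_zero]
  exact tendsto_of_le_liminf_of_limsup_le bot_le hzero.le

theorem IsPermMatrix.transpose_mul_self {m : ℕ} {M : Matrix (Fin m) (Fin m) ℝ}
    (h : IsPermMatrix M) : Mᵀ * M = 1 := by
  obtain ⟨σ, hσ⟩ := h
  have hM (i j : Fin m) : M i j = if σ j = i then 1 else 0 := congrFun (congrFun hσ i) j
  ext i j
  simp [Matrix.mul_apply, hM, Matrix.one_apply, eq_comm]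

/-- If the sensor graph has distinguished vertex `1` (here index `0`)
with no incoming edges, every vertex is reachable from it, the pairwise
associations are noiseless (`Π̃ᵢⱼ = Πᵢ₀ Πⱼ₀ᵀ` for permutation matrices `Πᵢ₀`) and
`Π₁(0)` is a permutation matrix, then for arbitrary initializations of the other
sensors the consensus protocol converges to `Πᵢ(t) → Πᵢ₀ P0` with
`P0 = Π₁₀ᵀ Π₁(0)`. -/
theorem consensus_converges_noiseless_distinguished
    (n m : ℕ) [NeZero n]
    (N : Fin n → Finset (Fin n))                      -- in-neighborhoods: j ∈ N i ↔ edge (j,i)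
    (Pt : Fin n → Fin n → Matrix (Fin m) (Fin m) ℝ)   -- pairwise associations Π̃ᵢⱼ
    (P0 : Fin n → Matrix (Fin m) (Fin m) ℝ)           -- ground-truth labels Πᵢ₀
    (hperm : ∀ i, IsPermMatrix (P0 i))
    (hnoiseless : ∀ i, ∀ j ∈ N i, Pt i j = P0 i * (P0 j)ᵀ)
    (hdist : N 0 = ∅)                                  -- vertex 1 has no incoming edges
    (hreach : ∀ i : Fin n,
      Relation.ReflTransGen (fun a b => a ∈ N b) 0 i)  -- all vertices reachable from vertex 1
    (P : ℕ → Fin n → Matrix (Fin m) (Fin m) ℝ)         -- iterates Πᵢ(t)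
    (hinit : IsPermMatrix (P 0 0))                     -- Π₁(0) is a permutation matrix
    (hupdate : ∀ t i, P (t + 1) i =
      (((N i).card : ℝ) + 1)⁻¹ • (P t i + ∑ j ∈ N i, Pt i j * P t j)) :
    ∀ i, Tendsto (fun t => P t i) atTop (nhds (P0 i * ((P0 0)ᵀ * P 0 0))) := by
  have hleft (i : Fin n) : (P0 i)ᵀ * P0 i = 1 := (hperm i).transpose_mul_self
  have hright (i : Fin n) : P0 i * (P0 i)ᵀ = 1 := mul_eq_one_comm.1 (hleft i)
  have hconst (t : ℕ) : P t 0 = P 0 0 := by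
    induction t with
    | zero => rfl
    | succ t ih => simp [hupdate, hdist, ih]
  set C := (P0 0)ᵀ * P 0 0 with hC
  have hy (t : ℕ) (i : Fin n) : (P0 i)ᵀ * P (t + 1) i - C = (((N i).card : ℝ) + 1)⁻¹ •
      (((P0 i)ᵀ * P t i - C) + ∑ j ∈ N i, ((P0 j)ᵀ * P t j - C)) := by
    have hpos : (0 : ℝ) < (N i).card + 1 := by positivity
    have hsum : (P0 i)ᵀ * ∑ j ∈ N i, Pt i j * P t j = ∑ j ∈ N i, (P0 j)ᵀ * P t j := by
      rw [Finset.mul_sum]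
      refine Finset.sum_congr rfl fun j hj => ?_
      rw [hnoiseless i j hj, ← Matrix.mul_assoc, ← Matrix.mul_assoc, hleft, Matrix.one_mul]
    have hCsum : C = (((N i).card : ℝ) + 1)⁻¹ • (C + (N i).card • C) := by
      rw [← Nat.cast_smul_eq_nsmul ℝ, eq_inv_smul_iff₀ hpos.ne', add_smul, one_smul, add_comm]
    rw [hupdate, Matrix.mul_smul, Matrix.mul_add, hsum, Finset.sum_sub_distrib,
      Finset.sum_const, sub_add_sub_comm, smul_sub, ← hCsum]
  intro i
  have hlim : Tendsto (fun t => (P0 i)ᵀ * P t i - C) atTop (nhds 0) := by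
    refine tendsto_pi_nhds.2 fun a => ?_
    exact tendsto_zero_of_averaging (E := Fin m → ℝ) N 0 hreach
      (fun t i => ((P0 i)ᵀ * P t i - C) a) (fun t => by simp only [hconst, hC, sub_self]; rfl)
      (fun t i => by
        ext b
        simpa [Matrix.sum_apply, Finset.sum_apply, -Finset.sum_sub_distrib] using congrFun (congrFun (hy t i) a) b) i
  have hP (t : ℕ) : P t i = P0 i * ((P0 i)ᵀ * P t i - C) + P0 i * C := by
    rw [← Matrix.mul_add, sub_add_cancel, ← Matrix.mul_assoc, hright, Matrix.one_mul]
  have hmul : Continuous fun M : Matrix (Fin m) (Fin m) ℝ => P0 i * M + P0 i * C := by fun_prop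
  simpa [Function.comp_def, ← hP] using (hmul.tendsto 0).comp hlim
end

section
/- Let 𝒢 be a weighted digraph on n vertices in which the first m vertices are distinguished and have no incoming edges, and suppose every non-distinguished vertex is reachable by a directed path from at least one distinguished vertex. Write F(𝒢) = (I+Δ)⁻¹(I+A) in block form [[I_m, 0], [F₂₁, F₂₂]]. Then there exists k > 0 such that every row of the block F_{21,k} of F(𝒢)^k = [[I_m, 0], [F_{21,k}, F₂₂^k]] contains at least one strictly positive entry, and consequently all eigenvalues of F₂₂ lie strictly inside the unit circle, so lim_{k→∞} F₂₂^k = 0. -/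
open Matrix Filter

section PowerPositivity

variable {ι : Type*} [Fintype ι] [DecidableEq ι]

theorem Matrix.pow_apply_pos_of_le {F : Matrix ι ι ℝ} (hF : F ∈ rowStochastic ℝ ι)
    (hdiag : ∀ i, 0 < F i i) {i j : ι} {k l : ℕ} (hkl : k ≤ l) (hk : 0 < (F ^ k) i j) :
    0 < (F ^ l) i j := by
  induction l, hkl using Nat.le_induction with
  | base => exact hk
  | succ l _ ih =>
    rw [pow_succ', mul_apply]
    exact Finset.sum_pos'
      (fun x _ => mul_nonneg (hF.1 i x) ((pow_mem hF l).1 x j))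
      ⟨i, Finset.mem_univ i, mul_pos (hdiag i) ih⟩

theorem Matrix.exists_pow_apply_pos_of_reflTransGen {F : Matrix ι ι ℝ}
    (hF : F ∈ rowStochastic ℝ ι) {r : ι → ι → Prop} (hr : ∀ a b, r a b → 0 < F b a)
    {a b : ι} (h : Relation.ReflTransGen r a b) : ∃ k : ℕ, 0 < (F ^ k) b a := by
  induction h with
  | refl => exact ⟨0, by simp⟩
  | @tail b c _ hbc ih =>
    obtain ⟨k, hk⟩ := ih
    refine ⟨k + 1, ?_⟩
    rw [pow_succ', mul_apply]
    exact Finset.sum_pos'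
      (fun x _ => mul_nonneg (hF.1 c x) ((pow_mem hF k).1 x a))
      ⟨b, Finset.mem_univ b, mul_pos (hr b c hbc) hk⟩

end PowerPositivity

theorem Matrix.submatrix_inr_pow {α β R : Type*} [Fintype α] [Fintype β] [DecidableEq α]
    [DecidableEq β] [Semiring R] {F : Matrix (α ⊕ β) (α ⊕ β) R}
    (hF : ∀ a b, F (Sum.inl a) (Sum.inr b) = 0) (k : ℕ) :
    F.submatrix Sum.inr Sum.inr ^ k = (F ^ k).submatrix Sum.inr Sum.inr := by
  induction k with
  | zero => ext i j; simp [one_apply]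
  | succ k ih =>
    ext i j
    simp [pow_succ, ih, mul_apply, hF]

section Convergence

attribute [local instance] Matrix.linftyOpNormedRing

/-- If the absolute row sums of `M` are at most one, and those of some positive power of `M` are
less than one, then the powers of `M` tend to zero. -/
theorem Matrix.tendsto_pow_zero_of_abs_row_sum_lt_one {ι : Type*} [Fintype ι] [DecidableEq ι]
    {M : Matrix ι ι ℝ} (hM : ∀ i, ∑ j, |M i j| ≤ 1) {k : ℕ} (hk : 0 < k)
    (hMk : ∀ i, ∑ j, |(M ^ k) i j| < 1) : Tendsto (fun n : ℕ => M ^ n) atTop (nhds 0) := by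
  have h1 : ‖M‖₊ ≤ 1 := by
    rw [linfty_opNNNorm_def]
    refine Finset.sup_le fun i _ => ?_
    rw [← NNReal.coe_le_coe]
    simpa using hM i
  have hk1 : ‖M ^ k‖₊ < 1 := by
    rw [linfty_opNNNorm_def, Finset.sup_lt_iff (by simp)]
    intro i _
    rw [← NNReal.coe_lt_coe]
    simpa using hMk i
  have hanti : Antitone fun n : ℕ => ‖M ^ n‖ := by
    refine antitone_nat_of_succ_le fun n => ?_
    rw [pow_succ]
    exact (norm_mul_le _ _).trans (mul_le_of_le_one_right (norm_nonneg _) h1)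
  have hsub : Tendsto (fun n : ℕ => M ^ (k * n)) atTop (nhds 0) := by
    simp_rw [pow_mul]
    exact tendsto_pow_atTop_nhds_zero_of_norm_lt_one hk1
  exact tendsto_zero_iff_norm_tendsto_zero.2 <|
    (tendsto_iff_tendsto_subseq_of_antitone hanti (tendsto_id.const_mul_atTop' hk)).2 <|
      tendsto_zero_iff_norm_tendsto_zero.1 hsub

end Convergence

theorem Matrix.norm_lt_one_of_mem_spectrum_of_tendsto_pow {ι : Type*} [Fintype ι] [DecidableEq ι]
    {N : Matrix ι ι ℂ} (hN : Tendsto (fun n : ℕ => N ^ n) atTop (nhds 0)) {μ : ℂ}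
    (hμ : μ ∈ spectrum ℂ N) : ‖μ‖ < 1 := by
  rw [← spectrum_toLin', ← Module.End.hasEigenvalue_iff_mem_spectrum] at hμ
  obtain ⟨v, hv⟩ := hμ.exists_hasEigenvector
  obtain ⟨i, hi⟩ := Function.ne_iff.1 hv.2
  have hpow : ∀ n : ℕ, (N ^ n *ᵥ v) i = μ ^ n * v i := fun n => by
    have := congrFun (hv.pow_apply n) i
    rwa [← toLin'_pow, toLin'_apply] at this
  have hlim : Tendsto (fun n : ℕ => (N ^ n *ᵥ v) i) atTop
      (nhds (((0 : Matrix ι ι ℂ) *ᵥ v) i)) := by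
    have hc : Continuous fun X : Matrix ι ι ℂ => (X *ᵥ v) i := by fun_prop
    exact (hc.tendsto 0).comp hN
  have := hlim.mul_const (v i)⁻¹
  simp only [hpow, mul_inv_cancel_right₀ hi, zero_mulVec, Pi.zero_apply, zero_mul] at this
  exact tendsto_pow_atTop_nhds_zero_iff_norm_lt_one.1 this

theorem Matrix.inv_one_add_diagonal_mul_apply {ι : Type*} [Fintype ι] [DecidableEq ι]
    {d : ι → ℝ} (hd : ∀ i, 0 ≤ d i) (B : Matrix ι ι ℝ) (i j : ι) :
    ((1 + diagonal d)⁻¹ * B) i j = (1 + d i)⁻¹ * B i j := by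
  have hinv : (1 + diagonal d)⁻¹ = diagonal fun i => (1 + d i)⁻¹ := by
    apply inv_eq_left_inv
    rw [← diagonal_one, diagonal_add, diagonal_mul_diagonal]
    congr 1
    funext i
    exact inv_mul_cancel₀ (by linarith [hd i])
  rw [hinv, diagonal_mul]

/-- For a weighted digraph whose first `m` vertices are
distinguished (no incoming edges), with every other vertex reachable from some
distinguished vertex, writing `F = (I+Δ)⁻¹(I+A)` in block form
`[[I_m, 0], [F₂₁, F₂₂]]`, there is `k > 0` such that every row of the block
`F_{21,k}` of `F^k` has a strictly positive entry; consequently all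
eigenvalues of `F₂₂` lie strictly inside the unit circle, so `F₂₂^k → 0`. -/
theorem F21_block_power_pos_rows_and_F22_spectrum_lt_one
    (m p : ℕ)
    (A : Matrix (Fin m ⊕ Fin p) (Fin m ⊕ Fin p) ℝ)    -- Aᵢⱼ = w(j,i) > 0 iff edge (j,i)
    (hA : ∀ i j, 0 ≤ A i j)
    (hdist : ∀ (k : Fin m) j, A (Sum.inl k) j = 0)    -- distinguished: no incoming edges
    (hreach : ∀ v : Fin p, ∃ u : Fin m,               -- reachable from a distinguished vertex
      Relation.ReflTransGen (fun a b => 0 < A b a) (Sum.inl u) (Sum.inr v))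
    (Δ F : Matrix (Fin m ⊕ Fin p) (Fin m ⊕ Fin p) ℝ)
    (hΔ : Δ = Matrix.diagonal fun i => ∑ j, A i j)
    (hF : F = (1 + Δ)⁻¹ * (1 + A))
    (F22 : Matrix (Fin p) (Fin p) ℝ)
    (hF22 : F22 = F.submatrix Sum.inr Sum.inr) :      -- the lower-right block of F
    (∃ k : ℕ, 0 < k ∧ ∀ v : Fin p, ∃ u : Fin m,
        0 < (F ^ k) (Sum.inr v) (Sum.inl u)) ∧
      (∀ μ ∈ spectrum ℂ (F22.map (algebraMap ℝ ℂ)), ‖μ‖ < 1) ∧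
      Tendsto (fun k : ℕ => F22 ^ k) atTop (nhds 0) := by
  have hd : ∀ i, 0 ≤ ∑ j, A i j := fun i => Finset.sum_nonneg fun j _ => hA i j
  have hpos : ∀ i, 0 < (1 + ∑ j, A i j)⁻¹ := fun i => inv_pos.2 (by linarith [hd i])
  have hFa : ∀ i j, F i j = (1 + ∑ j, A i j)⁻¹ * ((1 : Matrix _ _ ℝ) i j + A i j) := by
    intro i j
    rw [hF, hΔ, inv_one_add_diagonal_mul_apply hd, Matrix.add_apply]
  have hone : ∀ i j, 0 ≤ (1 : Matrix (Fin m ⊕ Fin p) (Fin m ⊕ Fin p) ℝ) i j := by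
    intro i j
    rw [one_apply]
    split_ifs <;> norm_num
  have hstoch : F ∈ rowStochastic ℝ (Fin m ⊕ Fin p) := by
    refine mem_rowStochastic_iff_sum.2 ⟨fun i j => ?_, fun i => ?_⟩
    · rw [hFa]
      exact mul_nonneg (hpos i).le (add_nonneg (hone i j) (hA i j))
    · simp_rw [hFa]
      rw [← Finset.mul_sum, Finset.sum_add_distrib]
      simp only [one_apply, Finset.sum_ite_eq, Finset.mem_univ, if_true]
      exact inv_mul_cancel₀ (by linarith [hd i])
  have hdiag : ∀ i, 0 < F i i := fun i => by
    rw [hFa, one_apply_eq]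
    exact mul_pos (hpos i) (by linarith [hA i i])
  have hedge : ∀ a b, 0 < A b a → 0 < F b a := fun a b hab => by
    rw [hFa]
    exact mul_pos (hpos b) (add_pos_of_nonneg_of_pos (hone b a) hab)
  have hzero : ∀ a b, F (Sum.inl a) (Sum.inr b) = 0 := fun a b => by
    rw [hFa, hdist, one_apply_ne Sum.inl_ne_inr, add_zero, mul_zero]
  have hpow : ∀ v : Fin p, ∃ (u : Fin m) (k : ℕ), 0 < (F ^ k) (Sum.inr v) (Sum.inl u) := by
    intro v
    obtain ⟨u, hu⟩ := hreach v
    exact ⟨u, exists_pow_apply_pos_of_reflTransGen hstoch hedge hu⟩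
  choose u l hul using hpow
  set K := Finset.univ.sup l + 1
  have hKpos : ∀ v, 0 < (F ^ K) (Sum.inr v) (Sum.inl (u v)) := fun v =>
    pow_apply_pos_of_le hstoch hdiag
      ((Finset.le_sup (Finset.mem_univ v)).trans (Nat.le_succ _)) (hul v)
  have hrow : ∀ k v, ∑ j, |(F22 ^ k) v j| = 1 - ∑ i, (F ^ k) (Sum.inr v) (Sum.inl i) := by
    intro k v
    have hk := pow_mem hstoch k
    have hsum := sum_row_of_mem_rowStochastic hk (Sum.inr v)
    rw [Fintype.sum_sum_type] at hsum
    rw [hF22, submatrix_inr_pow hzero, ← hsum, add_sub_cancel_left]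
    exact Finset.sum_congr rfl fun j _ => abs_of_nonneg (hk.1 _ _)
  have hlim : Tendsto (fun k : ℕ => F22 ^ k) atTop (nhds 0) := by
    refine tendsto_pow_zero_of_abs_row_sum_lt_one (k := K) (fun v => ?_) (Nat.succ_pos _)
      (fun v => ?_)
    · have := hrow 1 v
      rw [pow_one, pow_one] at this
      rw [this, sub_le_self_iff]
      exact Finset.sum_nonneg fun i _ => hstoch.1 _ _
    · rw [hrow, sub_lt_self_iff]
      exact Finset.sum_pos' (fun i _ => (pow_mem hstoch K).1 _ _)
        ⟨u v, Finset.mem_univ _, hKpos v⟩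
  refine ⟨⟨K, Nat.succ_pos _, fun v => ⟨u v, hKpos v⟩⟩, fun μ hμ => ?_, hlim⟩
  refine norm_lt_one_of_mem_spectrum_of_tendsto_pow ?_ hμ
  have hc : Continuous fun X : Matrix (Fin p) (Fin p) ℝ => X.map (algebraMap ℝ ℂ) :=
    continuous_id.matrix_map (by fun_prop)
  have := (hc.tendsto 0).comp hlim
  have hmap : ∀ k : ℕ, F22.map (algebraMap ℝ ℂ) ^ k = (F22 ^ k).map (algebraMap ℝ ℂ) := fun k =>
    (map_pow (algebraMap ℝ ℂ).mapMatrix F22 k).symm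
  simp_rw [hmap]
  rwa [Matrix.map_zero _ (map_zero _)] at this
end

section
/- Let 𝒢 be a weighted digraph on n vertices in which the first m vertices (m < n) are distinguished and have no incoming edges, and suppose every non-distinguished vertex is reachable by a directed path from at least one distinguished vertex. Let F(𝒢) = (I+Δ)⁻¹(I+A). Then: (a) the spectral radius of F(𝒢) equals 1; (b) 1 is an eigenvalue of F(𝒢) whose algebraic and geometric multiplicities both equal m; and (c) the powers F(𝒢)^k converge as k → ∞ to a matrix of the block form [[I_m, 0], [F̃₂₁, 0]]. -/
open Matrix Filter

/-- The powers of a substochastic matrix with no nonzero nonnegative fixed vector tend to `0`. -/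
theorem tendsto_pow_zero_of_substochastic {ι : Type*} [Fintype ι] [DecidableEq ι]
    (C : Matrix ι ι ℝ) (h0 : ∀ i j, 0 ≤ C i j) (h1 : ∀ i, ∑ j, C i j ≤ 1)
    (hfix : ∀ s : ι → ℝ, 0 ≤ s → C *ᵥ s = s → s = 0) :
    Tendsto (fun k : ℕ => C ^ k) atTop (nhds 0) := by
  have hpow : ∀ (k : ℕ) i j, 0 ≤ (C ^ k) i j := by
    intro k
    induction k with
    | zero =>
      intro i j
      rw [pow_zero, Matrix.one_apply]
      split_ifs <;> norm_num
    | succ k ih =>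
      intro i j
      rw [pow_succ, Matrix.mul_apply]
      exact Finset.sum_nonneg fun l _ => mul_nonneg (ih i l) (h0 l j)
  set s : ℕ → ι → ℝ := fun k i => ∑ j, (C ^ k) i j with hs
  have hs_nonneg : ∀ k i, 0 ≤ s k i := fun k i => Finset.sum_nonneg fun j _ => hpow k i j
  have hs_succ : ∀ k, s (k + 1) = C *ᵥ s k := by
    intro k
    ext i
    simp only [hs, pow_succ', Matrix.mul_apply, Matrix.mulVec, dotProduct, Finset.mul_sum]
    exact Finset.sum_comm
  have hs_anti : ∀ i, Antitone fun k => s k i := by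
    intro i
    refine antitone_nat_of_succ_le fun k => ?_
    simp only [hs, pow_succ, Matrix.mul_apply]
    rw [Finset.sum_comm]
    refine Finset.sum_le_sum fun j _ => ?_
    rw [← Finset.mul_sum]
    exact mul_le_of_le_one_right (hpow k i j) (h1 j)
  have hs_lim : ∀ i, Tendsto (fun k => s k i) atTop (nhds (⨅ k, s k i)) := fun i =>
    tendsto_atTop_ciInf (hs_anti i) ⟨0, by rintro _ ⟨k, rfl⟩; exact hs_nonneg k i⟩
  set t : ι → ℝ := fun i => ⨅ k, s k i with ht
  have hst : Tendsto s atTop (nhds t) := tendsto_pi_nhds.2 hs_lim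
  have ht_fix : C *ᵥ t = t := by
    have hc : Continuous fun v : ι → ℝ => C *ᵥ v := by fun_prop
    refine tendsto_nhds_unique ((hc.tendsto t).comp hst) ?_
    refine ((tendsto_add_atTop_iff_nat 1).2 hst).congr fun k => ?_
    simp [hs_succ]
  have ht_zero : t = 0 := hfix t (fun i => le_ciInf fun k => hs_nonneg k i) ht_fix
  refine tendsto_pi_nhds.2 fun i => tendsto_pi_nhds.2 fun j => ?_
  have hi : Tendsto (fun k => s k i) atTop (nhds 0) := by
    simpa [ht_zero] using tendsto_pi_nhds.1 hst i
  exact squeeze_zero (fun k => hpow k i j)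
    (fun k => Finset.single_le_sum (f := fun j => (C ^ k) i j)
      (fun l _ => hpow k i l) (Finset.mem_univ j)) hi

/-- If the powers of `C` tend to `0`, then `1 - C` is invertible. -/
theorem isUnit_one_sub_of_tendsto_pow_zero {ι : Type*} [Fintype ι] [DecidableEq ι]
    {C : Matrix ι ι ℝ} (hC : Tendsto (fun k : ℕ => C ^ k) atTop (nhds 0)) :
    IsUnit (1 - C).det := by
  rw [isUnit_iff_ne_zero]
  intro hdet
  obtain ⟨x, hx, hx0⟩ := Matrix.exists_mulVec_eq_zero_iff.2 hdet
  rw [Matrix.sub_mulVec, Matrix.one_mulVec, sub_eq_zero] at hx0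
  have hfix : ∀ k : ℕ, C ^ k *ᵥ x = x := by
    intro k
    induction k with
    | zero => simp
    | succ k ih => rw [pow_succ, ← Matrix.mulVec_mulVec, ← hx0, ih]
  have hc : Continuous fun M : Matrix ι ι ℝ => M *ᵥ x := by fun_prop
  have hlim := (hc.tendsto 0).comp hC
  rw [Matrix.zero_mulVec] at hlim
  exact hx (tendsto_nhds_unique (tendsto_const_nhds.congr fun k => (hfix k).symm) hlim)

theorem fromBlocks_one_zero_pow {ι κ R : Type*} [Fintype ι] [DecidableEq ι] [Fintype κ]
    [DecidableEq κ] [CommRing R] (B : Matrix κ ι R) (C : Matrix κ κ R)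
    (hC : IsUnit (1 - C).det) (k : ℕ) :
    Matrix.fromBlocks (1 : Matrix ι ι R) 0 B C ^ k =
      Matrix.fromBlocks 1 0 ((1 - C)⁻¹ * ((1 - C ^ k) * B)) (C ^ k) := by
  induction k with
  | zero => simp
  | succ k ih =>
    have hk : C ^ k * B = (1 - C)⁻¹ * ((1 - C) * (C ^ k * B)) := by
      rw [← Matrix.mul_assoc, Matrix.nonsing_inv_mul _ hC, Matrix.one_mul]
    rw [pow_succ, ih, Matrix.fromBlocks_multiply]
    congr 1
    · simp
    · simp
    · rw [Matrix.mul_one]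
      conv_lhs => rw [hk]
      rw [← Matrix.mul_add]
      congr 1
      simp only [pow_succ', Matrix.sub_mul, Matrix.one_mul, Matrix.mul_assoc]
      abel
    · simp [pow_succ]

theorem tendsto_fromBlocks_one_zero_pow {ι κ : Type*} [Fintype ι] [DecidableEq ι] [Fintype κ]
    [DecidableEq κ] (B : Matrix κ ι ℝ) (C : Matrix κ κ ℝ)
    (hC : Tendsto (fun k : ℕ => C ^ k) atTop (nhds 0)) :
    Tendsto (fun k : ℕ => Matrix.fromBlocks (1 : Matrix ι ι ℝ) 0 B C ^ k) atTop
      (nhds (Matrix.fromBlocks 1 0 ((1 - C)⁻¹ * B) 0)) := by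
  have hc : Continuous fun M : Matrix κ κ ℝ =>
      Matrix.fromBlocks (1 : Matrix ι ι ℝ) 0 ((1 - C)⁻¹ * ((1 - M) * B)) M := by fun_prop
  have hlim := (hc.tendsto 0).comp hC
  simp only [sub_zero, Matrix.one_mul] at hlim
  exact hlim.congr fun k =>
    (fromBlocks_one_zero_pow B C (isUnit_one_sub_of_tendsto_pow_zero hC) k).symm

theorem rootMultiplicity_charpoly_fromBlocks_one_zero {ι κ R : Type*} [Fintype ι] [DecidableEq ι]
    [Fintype κ] [DecidableEq κ] [Field R] (B : Matrix κ ι R) (C : Matrix κ κ R)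
    (hC : IsUnit (1 - C).det) :
    (Matrix.fromBlocks (1 : Matrix ι ι R) 0 B C).charpoly.rootMultiplicity 1 =
      Fintype.card ι := by
  have hroot : ¬ C.charpoly.IsRoot 1 := by
    rw [Polynomial.IsRoot, Matrix.eval_charpoly, map_one]
    exact hC.ne_zero
  rw [Matrix.charpoly_fromBlocks_zero₁₂, Matrix.charpoly_one, ← Polynomial.C_1,
    Polynomial.rootMultiplicity_mul, Polynomial.rootMultiplicity_X_sub_C_pow,
    Polynomial.rootMultiplicity_eq_zero hroot, add_zero]
  exact mul_ne_zero (pow_ne_zero _ (Polynomial.X_sub_C_ne_zero 1)) C.charpoly_monic.ne_zero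

theorem finrank_eigenspace_fromBlocks_one_zero {ι κ R : Type*} [Fintype ι] [DecidableEq ι]
    [Fintype κ] [DecidableEq κ] [Field R] (B : Matrix κ ι R) (C : Matrix κ κ R)
    (hC : IsUnit (1 - C).det) :
    Module.finrank R ↥(Module.End.eigenspace
      (Matrix.toLin' (Matrix.fromBlocks (1 : Matrix ι ι R) 0 B C)) 1) = Fintype.card ι := by
  have hmem : ∀ x : ι ⊕ κ → R, x ∈ Module.End.eigenspace
      (Matrix.toLin' (Matrix.fromBlocks (1 : Matrix ι ι R) 0 B C)) 1 ↔
      (1 - C) *ᵥ (x ∘ Sum.inr) = B *ᵥ (x ∘ Sum.inl) := by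
    intro x
    rw [Module.End.mem_eigenspace_iff, one_smul, Matrix.toLin'_apply, Matrix.fromBlocks_mulVec,
      Matrix.sub_mulVec, Matrix.one_mulVec, Matrix.one_mulVec, Matrix.zero_mulVec, add_zero,
      sub_eq_iff_eq_add]
    constructor
    · intro h
      ext i
      simpa using (congrFun h (Sum.inr i)).symm
    · intro h
      ext (i | i)
      · simp
      · simpa using (congrFun h i).symm
  let f := (LinearMap.funLeft R R (Sum.inl : ι → ι ⊕ κ)).comp (Module.End.eigenspace
    (Matrix.toLin' (Matrix.fromBlocks (1 : Matrix ι ι R) 0 B C)) 1).subtype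
  have hf : Function.Bijective f := by
    constructor
    · rw [← LinearMap.ker_eq_bot, LinearMap.ker_eq_bot']
      rintro ⟨x, hx⟩ hfx
      have hl : x ∘ Sum.inl = 0 := hfx
      have hr := (hmem x).1 hx
      rw [hl, Matrix.mulVec_zero] at hr
      have hr' := Matrix.eq_zero_of_mulVec_eq_zero hC.ne_zero hr
      ext (i | i)
      · exact congrFun hl i
      · exact congrFun hr' i
    · intro a
      refine ⟨⟨Sum.elim a ((1 - C)⁻¹ *ᵥ (B *ᵥ a)), (hmem _).2 ?_⟩, rfl⟩
      rw [Sum.elim_comp_inr, Sum.elim_comp_inl, Matrix.mulVec_mulVec,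
        Matrix.mul_nonsing_inv _ hC, Matrix.one_mulVec]
  rw [(LinearEquiv.ofBijective f hf).finrank_eq, Module.finrank_pi]

section SpectralRadius

attribute [local instance] Matrix.linftyOpNormedRing Matrix.linftyOpNormedAlgebra

theorem spectralRadius_stochastic {ι : Type*} [Fintype ι] [DecidableEq ι] [Nonempty ι]
    (F : Matrix ι ι ℝ) (h0 : ∀ i j, 0 ≤ F i j) (h1 : ∀ i, ∑ j, F i j = 1) :
    spectralRadius ℂ (F.map (algebraMap ℝ ℂ)) = 1 := by
  apply le_antisymm
  · have hnorm : ‖F.map (algebraMap ℝ ℂ)‖₊ ≤ 1 := by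
      rw [Matrix.linfty_opNNNorm_def]
      refine Finset.sup_le fun i _ => ?_
      rw [← NNReal.coe_le_coe]
      push_cast
      simp only [Matrix.map_apply, Complex.coe_algebraMap, Complex.norm_real, Real.norm_eq_abs,
        abs_of_nonneg (h0 _ _), h1, le_refl]
    have : NormOneClass (Matrix ι ι ℂ) := Matrix.linfty_opNormOneClass
    exact (spectrum.spectralRadius_le_nnnorm _).trans (by exact_mod_cast hnorm)
  · have hmem : (1 : ℂ) ∈ spectrum ℂ (F.map (algebraMap ℝ ℂ)) := by
      rw [spectrum.mem_iff, map_one, Matrix.isUnit_iff_isUnit_det, isUnit_iff_ne_zero, not_not]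
      refine Matrix.exists_mulVec_eq_zero_iff.1 ⟨1, one_ne_zero, ?_⟩
      rw [Matrix.sub_mulVec, Matrix.one_mulVec, sub_eq_zero]
      ext i
      have := congrArg (algebraMap ℝ ℂ) (h1 i)
      rw [map_sum, map_one] at this
      simpa [Matrix.mulVec, dotProduct] using this.symm
    calc (1 : ENNReal) = ‖(1 : ℂ)‖₊ := by simp
      _ ≤ _ := le_iSup₂ (f := fun (k : ℂ) (_ : k ∈ spectrum ℂ (F.map (algebraMap ℝ ℂ))) =>
          (‖k‖₊ : ENNReal)) 1 hmem

end SpectralRadius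

/-- Maximum principle: a function harmonic for the weights `A` takes its maximal value at every
vertex from which a maximum point can be reached. -/
theorem eq_of_reflTransGen_of_harmonic {ι : Type*} [Fintype ι] {A : Matrix ι ι ℝ}
    (hA : ∀ i j, 0 ≤ A i j) {h : ι → ℝ} (hh : ∀ i, ∑ j, A i j * (h i - h j) = 0)
    {u v : ι} (hv : ∀ w, h w ≤ h v) (huv : Relation.ReflTransGen (fun a b => 0 < A b a) u v) :
    h u = h v := by
  induction huv using Relation.ReflTransGen.head_induction_on with
  | refl => rfl
  | @head a c hac _ ih =>
    have hz := (Finset.sum_eq_zero_iff_of_nonneg fun j _ =>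
      mul_nonneg (hA c j) (sub_nonneg.2 (ih ▸ hv j))).1 (hh c) a (Finset.mem_univ a)
    have := (mul_eq_zero.1 hz).resolve_left hac.ne'
    linarith

/-- For a weighted digraph whose first `m` vertices (`m < n`) are
distinguished (no incoming edges), with every other vertex reachable from some
distinguished vertex, `F = (I+Δ)⁻¹(I+A)` satisfies: (a) its spectral radius is
`1`; (b) `1` is an eigenvalue with algebraic and geometric multiplicity `m`;
(c) the powers `F^k` converge to a matrix of the block form
`[[I_m, 0], [F̃₂₁, 0]]`. -/
theorem F_distinguished_spectrum_and_power_limit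
    (m p : ℕ) (hp : 0 < p)                            -- m < n, with p = n - m
    (A : Matrix (Fin m ⊕ Fin p) (Fin m ⊕ Fin p) ℝ)    -- Aᵢⱼ = w(j,i) > 0 iff edge (j,i)
    (hA : ∀ i j, 0 ≤ A i j)
    (hdist : ∀ (k : Fin m) j, A (Sum.inl k) j = 0)    -- distinguished: no incoming edges
    (hreach : ∀ v : Fin p, ∃ u : Fin m,               -- reachable from a distinguished vertex
      Relation.ReflTransGen (fun a b => 0 < A b a) (Sum.inl u) (Sum.inr v))
    (Δ F : Matrix (Fin m ⊕ Fin p) (Fin m ⊕ Fin p) ℝ)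
    (hΔ : Δ = Matrix.diagonal fun i => ∑ j, A i j)
    (hF : F = (1 + Δ)⁻¹ * (1 + A)) :
    spectralRadius ℂ (F.map (algebraMap ℝ ℂ)) = 1 ∧
      F.charpoly.rootMultiplicity 1 = m ∧
      Module.finrank ℝ ↥(Module.End.eigenspace (Matrix.toLin' F) 1) = m ∧
      ∃ F21t : Matrix (Fin p) (Fin m) ℝ,
        Tendsto (fun k : ℕ => F ^ k) atTop
          (nhds (Matrix.fromBlocks 1 0 F21t 0)) := by
  have hd : ∀ i, 0 < 1 + ∑ j, A i j := fun i =>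
    add_pos_of_pos_of_nonneg one_pos (Finset.sum_nonneg fun j _ => hA i j)
  have hF' : ∀ i j, F i j = (1 + ∑ l, A i l)⁻¹ * ((1 : Matrix _ _ ℝ) i j + A i j) := by
    have hinv : (1 + Δ)⁻¹ = Matrix.diagonal fun i => (1 + ∑ l, A i l)⁻¹ := by
      refine Matrix.inv_eq_right_inv ?_
      rw [hΔ, ← Matrix.diagonal_one, Matrix.diagonal_add, Matrix.diagonal_mul_diagonal]
      congr 1
      ext i
      exact mul_inv_cancel₀ (hd i).ne'
    intro i j
    rw [hF, hinv, Matrix.diagonal_mul, Matrix.add_apply]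
  have hF0 : ∀ i j, 0 ≤ F i j := by
    intro i j
    rw [hF']
    refine mul_nonneg (inv_nonneg.2 (hd i).le) (add_nonneg ?_ (hA i j))
    rw [Matrix.one_apply]
    split_ifs <;> norm_num
  have hF1 : ∀ i, ∑ j, F i j = 1 := by
    intro i
    simp only [hF', ← Finset.mul_sum, Finset.sum_add_distrib, Matrix.one_apply,
      Finset.sum_ite_eq, Finset.mem_univ, if_true]
    exact inv_mul_cancel₀ (hd i).ne'
  have hFl : ∀ (k : Fin m) j, F (Sum.inl k) j = (1 : Matrix (Fin m ⊕ Fin p) _ ℝ) (Sum.inl k) j := by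
    intro k j
    simp [hF', hdist]
  have hblock : F = Matrix.fromBlocks 1 0 F.toBlocks₂₁ F.toBlocks₂₂ := by
    ext (i | i) (j | j) <;> simp [hFl, Matrix.one_apply, Matrix.toBlocks₂₁, Matrix.toBlocks₂₂]
  have hC : Tendsto (fun k : ℕ => F.toBlocks₂₂ ^ k) atTop (nhds 0) := by
    refine tendsto_pow_zero_of_substochastic _ (fun i j => hF0 _ _) (fun i => ?_) ?_
    · have hi := hF1 (Sum.inr i)
      rw [Fintype.sum_sum_type] at hi
      have : 0 ≤ ∑ j, F (Sum.inr i) (Sum.inl j) := Finset.sum_nonneg fun j _ => hF0 _ _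
      change ∑ j, F (Sum.inr i) (Sum.inr j) ≤ 1
      linarith
    · intro s hs hfix
      set h : Fin m ⊕ Fin p → ℝ := Sum.elim 0 s with hh
      have hharm : ∀ i, ∑ j, A i j * (h i - h j) = 0 := by
        rintro (k | i)
        · simp [hdist]
        · have hi := congrFun hfix i
          simp only [Matrix.mulVec, dotProduct, Matrix.toBlocks₂₂, Matrix.of_apply, hF',
            mul_assoc, ← Finset.mul_sum, add_mul, Finset.sum_add_distrib] at hi
          rw [inv_mul_eq_iff_eq_mul₀ (hd _).ne'] at hi
          simp [Matrix.one_apply] at hi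
          simp only [hh, mul_sub, Finset.sum_sub_distrib, ← Finset.sum_mul, Fintype.sum_sum_type,
            Sum.elim_inl, Sum.elim_inr, Pi.zero_apply, mul_zero, Finset.sum_const_zero]
          linarith
      have : Nonempty (Fin p) := ⟨⟨0, hp⟩⟩
      obtain ⟨v, hv⟩ := Finite.exists_max s
      obtain ⟨u, hu⟩ := hreach v
      have hmax : s v = 0 := by
        refine (eq_of_reflTransGen_of_harmonic hA hharm ?_ hu).symm
        rintro (k | i)
        · exact hs v
        · exact hv i
      exact le_antisymm (fun i => (hv i).trans_eq hmax) hs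
  have hdet := isUnit_one_sub_of_tendsto_pow_zero hC
  have : Nonempty (Fin m ⊕ Fin p) := ⟨Sum.inr ⟨0, hp⟩⟩
  refine ⟨spectralRadius_stochastic F hF0 hF1, ?_, ?_, (1 - F.toBlocks₂₂)⁻¹ * F.toBlocks₂₁, ?_⟩
  · rw [hblock, rootMultiplicity_charpoly_fromBlocks_one_zero _ _ hdet, Fintype.card_fin]
  · rw [hblock, finrank_eigenspace_fromBlocks_one_zero _ _ hdet, Fintype.card_fin]
  · have hlim := tendsto_fromBlocks_one_zero_pow (ι := Fin m) F.toBlocks₂₁ F.toBlocks₂₂ hC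
    rwa [← hblock] at hlim
end
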